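/- Let p ≥ 1 and let a = (a_1,…,a_p) be a tuple with each a_j ∈ {0,1}. Define f : {0,1,…,p+1} → {0,1,…,p+1} as follows: f(0) is the least j ∈ {1,…,p} with a_j = 0, or p+1 if no such j exists; for 1 ≤ i ≤ p with a_i = 0, f(i) is the least j with i < j ≤ p and a_j = 0, or p+1 if no such j exists; for 1 ≤ i ≤ p with a_i = 1, f(i) is the greatest j with 1 ≤ j < i and a_j = 1, or 0 if no such j exists; f(p+1) is the greatest j ∈ {1,…,p} with a_j = 1, or 0 if no such j exists. Then f is a bijection of {0,1,…,p+1} and is a single cycle of length p+2 (equivalently, the f-orbit of 0 is all of {0,1,…,p+1}). -/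

import Mathlib

/-- The least `j` with `i < j ≤ p` and `a j = 0`, or `p+1` if there is none. -/
def nextZero (a : ℕ → Fin 2) (p i : ℕ) : ℕ :=
  (((Finset.Icc (i + 1) p).filter (fun j => a j = 0)).min).untopD (p + 1)

/-- The greatest `j` with `1 ≤ j < i` and `a j = 1`, or `0` if there is none. -/
def prevOne (a : ℕ → Fin 2) (i : ℕ) : ℕ :=
  (((Finset.Icc 1 (i - 1)).filter (fun j => a j = 1)).max).unbotD 0

/-- The map `f` on `{0, 1, …, p+1}` induced by the tuple `a = (a_1, …, a_p)`:
`f 0` is the least `j ∈ [1,p]` with `a j = 0` (or `p+1`); for `1 ≤ i ≤ p`,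
if `a i = 0` then `f i` is the next zero after `i` (or `p+1`), and if `a i = 1`
then `f i` is the previous one before `i` (or `0`); `f (p+1)` is the greatest
`j ∈ [1,p]` with `a j = 1` (or `0`). -/
def cyc (a : ℕ → Fin 2) (p : ℕ) (i : ℕ) : ℕ :=
  if i = 0 then nextZero a p 0
  else if i ≤ p then (if a i = 0 then nextZero a p i else prevOne a i)
  else prevOne a (p + 1)

theorem nextZero_spec (a : ℕ → Fin 2) {p i : ℕ} (hi : i ≤ p) :
    i < nextZero a p i ∧ nextZero a p i ≤ p + 1 ∧
      (nextZero a p i = p + 1 ∨ a (nextZero a p i) = 0) ∧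
      ∀ j, i < j → j < nextZero a p i → a j ≠ 0 := by
  unfold nextZero
  set s := (Finset.Icc (i + 1) p).filter (fun j => a j = 0) with hs
  have mem : ∀ j, j ∈ s ↔ (i + 1 ≤ j ∧ j ≤ p) ∧ a j = 0 := by simp [hs]
  rcases s.eq_empty_or_nonempty with he | hne
  · have htop : s.min.untopD (p + 1) = p + 1 := by simp [he]
    rw [htop]
    refine ⟨by omega, le_rfl, .inl rfl, fun j h₁ h₂ h₃ => ?_⟩
    have := (mem j).2 ⟨by omega, h₃⟩
    simp [he] at this
  · obtain ⟨m, hm⟩ := Finset.min_of_nonempty hne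
    rw [hm, WithTop.untopD_coe]
    obtain ⟨hm₁, hm₂⟩ := (mem m).1 (Finset.mem_of_min hm)
    refine ⟨by omega, by omega, .inr hm₂, fun j h₁ h₂ h₃ => ?_⟩
    have := Finset.min_le_of_eq ((mem j).2 ⟨by omega, h₃⟩) hm
    omega

theorem prevOne_spec (a : ℕ → Fin 2) {i : ℕ} (hi : 1 ≤ i) :
    prevOne a i < i ∧ (prevOne a i = 0 ∨ a (prevOne a i) = 1) ∧
      ∀ j, prevOne a i < j → j < i → a j ≠ 1 := by
  unfold prevOne
  set s := (Finset.Icc 1 (i - 1)).filter (fun j => a j = 1) with hs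
  have mem : ∀ j, j ∈ s ↔ (1 ≤ j ∧ j ≤ i - 1) ∧ a j = 1 := by simp [hs]
  rcases s.eq_empty_or_nonempty with he | hne
  · have hbot : s.max.unbotD 0 = 0 := by simp [he]
    rw [hbot]
    refine ⟨by omega, .inl rfl, fun j h₁ h₂ h₃ => ?_⟩
    have := (mem j).2 ⟨by omega, h₃⟩
    simp [he] at this
  · obtain ⟨m, hm⟩ := Finset.max_of_nonempty hne
    rw [hm, WithBot.unbotD_coe]
    obtain ⟨hm₁, hm₂⟩ := (mem m).1 (Finset.mem_of_max hm)
    refine ⟨by omega, .inr hm₂, fun j h₁ h₂ h₃ => ?_⟩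
    have := Finset.le_max_of_eq ((mem j).2 ⟨by omega, h₃⟩) hm
    omega

theorem cyc_eq_of_next {a : ℕ → Fin 2} {p i m : ℕ} (hi : i = 0 ∨ a i = 0) (him : i < m)
    (hmp : m ≤ p + 1) (hm : m = p + 1 ∨ a m = 0) (hb : ∀ j, i < j → j < m → a j = 1) :
    cyc a p i = m := by
  have hc : cyc a p i = nextZero a p i := by
    unfold cyc
    split_ifs <;> grind
  obtain ⟨h₁, h₂, h₃, h₄⟩ := nextZero_spec a (show i ≤ p by omega)
  rw [hc]
  rcases lt_trichotomy (nextZero a p i) m with h | h | h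
  · have := hb _ h₁ h
    grind
  · exact h
  · have := h₄ m him h
    grind

theorem cyc_eq_of_prev {a : ℕ → Fin 2} {p i m : ℕ} (hi : i = p + 1 ∨ i ≤ p ∧ a i = 1)
    (him : m < i) (hm : m = 0 ∨ a m = 1) (hb : ∀ j, m < j → j < i → a j = 0) :
    cyc a p i = m := by
  have hc : cyc a p i = prevOne a i := by
    unfold cyc
    split_ifs <;> grind
  obtain ⟨h₁, h₂, h₃⟩ := prevOne_spec a (show 1 ≤ i by omega)
  rw [hc]
  rcases lt_trichotomy (prevOne a i) m with h | h | h
  · have := h₃ m h him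
    grind
  · exact h
  · have := hb _ h h₁
    grind

theorem cyc_mapsTo (a : ℕ → Fin 2) (p : ℕ) :
    Set.MapsTo (cyc a p) (Set.Iic (p + 1)) (Set.Iic (p + 1)) := by
  intro i hi
  rw [Set.mem_Iic] at hi ⊢
  unfold cyc
  split_ifs with h₀ h₁
  · exact (nextZero_spec a (Nat.zero_le p)).2.1
  · exact (nextZero_spec a h₁).2.1
  · have := (prevOne_spec a (show 1 ≤ i by omega)).1
    omega
  · exact (prevOne_spec a (show 1 ≤ p + 1 by omega)).1.le

/-- The number of zeros among `a 1, …, a n`. -/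
def zeroCount (a : ℕ → Fin 2) (n : ℕ) : ℕ := Nat.count (fun j => a (j + 1) = 0) n

theorem zeroCount_succ (a : ℕ → Fin 2) (n : ℕ) :
    zeroCount a (n + 1) = zeroCount a n + if a (n + 1) = 0 then 1 else 0 :=
  Nat.count_succ _ n

/-- After `zeroCount a n` steps, the orbit of `0` is at the last zero up to `n`
(or still at `0`). -/
theorem cyc_iterate_zeroCount (a : ℕ → Fin 2) {p n : ℕ} (hn : n ≤ p) :
    ∃ i ≤ n, (i = 0 ∨ a i = 0) ∧ (∀ j, i < j → j ≤ n → a j = 1) ∧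
      (cyc a p)^[zeroCount a n] 0 = i := by
  induction n with
  | zero => exact ⟨0, le_rfl, .inl rfl, fun j _ _ => by omega, by simp [zeroCount]⟩
  | succ n ih =>
    obtain ⟨i, hi, h₀, hb, hit⟩ := ih (by omega)
    rw [zeroCount_succ]
    by_cases h : a (n + 1) = 0
    · refine ⟨n + 1, le_rfl, .inr h, fun j _ _ => by omega, ?_⟩
      rw [if_pos h, Function.iterate_succ_apply', hit]
      exact cyc_eq_of_next h₀ (by omega) (by omega) (.inr h) fun j h₁ h₂ => hb j h₁ (by omega)
    · refine ⟨i, by omega, h₀, fun j h₁ h₂ => ?_, by rwa [if_neg h, add_zero]⟩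
      rcases h₂.eq_or_lt with rfl | h₂
      · grind
      · exact hb j h₁ (by omega)

theorem cyc_iterate_last (a : ℕ → Fin 2) (p : ℕ) :
    (cyc a p)^[zeroCount a p + 1] 0 = p + 1 := by
  obtain ⟨i, hi, h₀, hb, hit⟩ := cyc_iterate_zeroCount a (le_refl p)
  rw [Function.iterate_succ_apply', hit]
  exact cyc_eq_of_next h₀ (by omega) le_rfl (.inl rfl) fun j h₁ h₂ => hb j h₁ (by omega)

/-- After `n + 1 + zeroCount a m` steps, where `m + n = p`, the orbit of `0` is at the first one
after `m` (or at `p + 1`). -/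
theorem cyc_iterate_descending (a : ℕ → Fin 2) {p n m : ℕ} (h_sum : m + n = p) :
    ∃ i, m < i ∧ (i = p + 1 ∨ i ≤ p ∧ a i = 1) ∧ (∀ j, m < j → j < i → a j = 0) ∧
      (cyc a p)^[n + 1 + zeroCount a m] 0 = i := by
  induction n generalizing m with
  | zero =>
    obtain rfl : m = p := by omega
    refine ⟨m + 1, by omega, .inl rfl, fun j _ _ => by omega, ?_⟩
    rw [zero_add, add_comm]
    exact cyc_iterate_last a m
  | succ n ih =>
    obtain ⟨i, hi, h₁, hb, hit⟩ := ih (m := m + 1) (by omega)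
    rw [zeroCount_succ] at hit
    by_cases h : a (m + 1) = 0
    · rw [if_pos h] at hit
      refine ⟨i, by omega, h₁, fun j h₂ h₃ => ?_, ?_⟩
      · rcases eq_or_lt_of_le (Nat.succ_le_of_lt h₂) with rfl | h₂
        · exact h
        · exact hb j h₂ h₃
      · rwa [show n + 1 + 1 + zeroCount a m = n + 1 + (zeroCount a m + 1) by omega]
    · have h_one : a (m + 1) = 1 := by grind
      rw [if_neg h] at hit
      refine ⟨m + 1, by omega, .inr ⟨by omega, h_one⟩, fun j _ _ => by omega, ?_⟩
      rw [show n + 1 + 1 + zeroCount a m = n + 1 + (zeroCount a m + 0) + 1 by omega,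
        Function.iterate_succ_apply', hit]
      exact cyc_eq_of_prev h₁ hi (.inr h_one) hb

theorem zeroCount_le (a : ℕ → Fin 2) (n : ℕ) : zeroCount a n ≤ n := Nat.count_le _

theorem cyc_iterate_period (a : ℕ → Fin 2) (p : ℕ) : (cyc a p)^[p + 2] 0 = 0 := by
  obtain ⟨i, hi, h₁, hb, hit⟩ := cyc_iterate_descending a (zero_add p)
  rw [show zeroCount a 0 = 0 from Nat.count_zero _, add_zero] at hit
  rw [Function.iterate_succ_apply', hit]
  exact cyc_eq_of_prev h₁ hi (.inl rfl) hb

theorem exists_cyc_iterate_eq (a : ℕ → Fin 2) {p m : ℕ} (hm : m ≤ p + 1) :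
    ∃ k < p + 2, (cyc a p)^[k] 0 = m := by
  rcases Nat.eq_zero_or_pos m with rfl | hpos
  · exact ⟨0, by omega, rfl⟩
  rcases hm.eq_or_lt with rfl | hlt
  · have := zeroCount_le a p
    exact ⟨zeroCount a p + 1, by omega, cyc_iterate_last a p⟩
  obtain ⟨n, rfl⟩ : ∃ n, m = n + 1 := ⟨m - 1, by omega⟩
  have hle := zeroCount_le a n
  by_cases h : a (n + 1) = 0
  · obtain ⟨i, hi, -, hb, hit⟩ := cyc_iterate_zeroCount a (show n + 1 ≤ p by omega)
    refine ⟨_, ?_, hit.trans ?_⟩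
    · have := zeroCount_le a (n + 1)
      omega
    · by_contra hne
      have := hb (n + 1) (by omega) le_rfl
      grind
  · obtain ⟨i, hi, -, hb, hit⟩ :=
      cyc_iterate_descending a (show n + (p - n) = p by omega)
    refine ⟨_, by omega, hit.trans ?_⟩
    by_contra hne
    exact h (hb (n + 1) (by omega) (by omega))

theorem cyc_surjOn (a : ℕ → Fin 2) (p : ℕ) :
    Set.SurjOn (cyc a p) (Set.Iic (p + 1)) (Set.Iic (p + 1)) := by
  have h_orbit (k : ℕ) : (cyc a p)^[k] 0 ∈ Set.Iic (p + 1) :=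
    (cyc_mapsTo a p).iterate k (Nat.zero_le _)
  intro m hm
  obtain ⟨k, -, rfl⟩ := exists_cyc_iterate_eq a hm
  cases k with
  | zero =>
    refine ⟨_, h_orbit (p + 1), ?_⟩
    rw [← Function.iterate_succ_apply' (cyc a p), cyc_iterate_period]
    rfl
  | succ k => exact ⟨_, h_orbit k, (Function.iterate_succ_apply' _ k 0).symm⟩

/-- The map `f = cyc a p` is a bijection of `{0, 1, …, p+1}` and is a single
cycle of length `p+2`: the `f`-orbit of `0` is all of `{0, 1, …, p+1}`. -/
theorem cyc_bijOn_and_single_cycle (p : ℕ) (hp : 1 ≤ p) (a : ℕ → Fin 2) :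
    Set.BijOn (cyc a p) (Set.Iic (p + 1)) (Set.Iic (p + 1)) ∧
    ∀ m ∈ Set.Iic (p + 1), ∃ k < p + 2, (cyc a p)^[k] 0 = m := by
  refine ⟨⟨cyc_mapsTo a p, ?_, cyc_surjOn a p⟩, fun m hm => exists_cyc_iterate_eq a hm⟩
  have h := Finset.injOn_of_surjOn_of_card_le (s := Finset.Iic (p + 1)) (t := Finset.Iic (p + 1))
    (cyc a p) (by simpa using cyc_mapsTo a p) (by simpa using cyc_surjOn a p) le_rfl
  simpa using h
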